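/- arXiv:1910.03509 — 2 statements merged into one kernel-verified Lean document; each statement's English description precedes it below -/
import Mathlib

section
/- Let κ : ℝ → ℝ be a function, let v, θ, c, μ be real numbers and z > 0. Suppose α : ℝ → ℂ² is differentiable and satisfies −i·v·σ₁·α′(s) + θ·κ(s)·σ₃·α(s) = z·α(s) for all s ∈ ℝ. Set λ := √(z² + c²μ²), β := (λ+z)·α + c·μ·(σ₂∘α), and γ := c·μ·α − (λ+z)·(σ₂∘α). Then for all s ∈ ℝ: −i·v·σ₁·β′(s) + c·μ·σ₂·β(s) + θ·κ(s)·σ₃·β(s) = λ·β(s), and −i·v·σ₁·γ′(s) + c·μ·σ₂·γ(s) + θ·κ(s)·σ₃·γ(s) = −λ·γ(s); moreover β(s) ≠ 0 and γ(s) ≠ 0 at every point s with α(s) ≠ 0. Thus every positive eigenvalue z of the μ = 0 Dirac operator produces the pair of eigenvalues ±√(z² + c²μ²) of the μ-dependent Dirac operator. -/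
/-- The Pauli matrix σ₁ = [[0,1],[1,0]]. -/
noncomputable def σ1 : Matrix (Fin 2) (Fin 2) ℂ := !![0, 1; 1, 0]

/-- The Pauli matrix σ₂ = [[0,-i],[i,0]]. -/
noncomputable def σ2 : Matrix (Fin 2) (Fin 2) ℂ := !![0, -Complex.I; Complex.I, 0]

/-- The Pauli matrix σ₃ = [[1,0],[0,-1]]. -/
noncomputable def σ3 : Matrix (Fin 2) (Fin 2) ℂ := !![1, 0; 0, -1]

lemma σ2_mulVec_mulVec (w : Fin 2 → ℂ) : σ2.mulVec (σ2.mulVec w) = w := by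
  ext i
  fin_cases i <;> simp [σ2, Matrix.mulVec, dotProduct, ← mul_assoc]

lemma hasDerivAt_smul_add_smul_σ2_mulVec {α : ℝ → Fin 2 → ℂ} {α' : Fin 2 → ℂ} {s : ℝ}
    (hα : HasDerivAt α α' s) (a b : ℂ) :
    HasDerivAt (fun t => a • α t + b • σ2.mulVec (α t)) (a • α' + b • σ2.mulVec α') s := by
  have h : HasDerivAt (fun t => σ2.mulVec (α t)) (σ2.mulVec α') s :=
    ((σ2.mulVecLin.restrictScalars ℝ).toContinuousLinearMap).hasFDerivAt.comp_hasDerivAt s hα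
  exact (hα.const_smul a).add (h.const_smul b)

/-- An eigenvector `(a, b)` of `!![z, m; m, -z]` turns a solution of the massless equation at
energy `z` into a solution of the equation with the extra term `m σ₂`. -/
lemma dirac_smul_add_smul_σ2_mulVec {p q z m l a b : ℂ} {w w' : Fin 2 → ℂ}
    (h : p • σ1.mulVec w' + q • σ3.mulVec w = z • w)
    (ha : a * z + b * m = l * a) (hb : a * m - b * z = l * b) :
    p • σ1.mulVec (a • w' + b • σ2.mulVec w') + m • σ2.mulVec (a • w + b • σ2.mulVec w)
      + q • σ3.mulVec (a • w + b • σ2.mulVec w) = l • (a • w + b • σ2.mulVec w) := by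
  have h0 := congrFun h 0
  have h1 := congrFun h 1
  simp [σ1, σ3, dotProduct] at h0 h1
  ext i
  fin_cases i <;> simp [σ1, σ2, σ3, dotProduct, Matrix.vecHead, Matrix.vecTail]
  · linear_combination a * h0 + b * Complex.I * h1 + w 0 * ha - Complex.I * w 1 * hb
      - b * m * w 0 * Complex.I_mul_I
  · linear_combination a * h1 - b * Complex.I * h0 + w 1 * ha + Complex.I * w 0 * hb
      - b * m * w 1 * Complex.I_mul_I

lemma smul_add_smul_σ2_mulVec_ne_zero {a b : ℂ} {w : Fin 2 → ℂ}
    (hab : a ^ 2 - b ^ 2 ≠ 0) (hw : w ≠ 0) : a • w + b • σ2.mulVec w ≠ 0 := by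
  intro h
  have key : (a ^ 2 - b ^ 2) • w
      = a • (a • w + b • σ2.mulVec w) - b • σ2.mulVec (a • w + b • σ2.mulVec w) := by
    rw [Matrix.mulVec_add, Matrix.mulVec_smul, Matrix.mulVec_smul, σ2_mulVec_mulVec]
    module
  rw [h, Matrix.mulVec_zero, smul_zero, smul_zero, sub_zero] at key
  exact (smul_ne_zero hab hw) key

/-- **Eigenvalue branches `±√(z² + c²μ²)` of the μ-dependent Dirac operator.**
Suppose `α` is differentiable and solves the `μ = 0` equation
`-i v σ₁ α' + θ κ σ₃ α = z α` with `z > 0`.  Set `λ = √(z² + c²μ²)`,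
`β = (λ+z) α + c μ (σ₂ ∘ α)` and `γ = c μ α - (λ+z) (σ₂ ∘ α)`.  Then `β` solves
the μ-dependent equation with eigenvalue `λ`, `γ` with eigenvalue `-λ`, and both
are nonzero wherever `α` is. -/
theorem dirac_mu_branches
    (κ : ℝ → ℝ) (v θ c μ z : ℝ) (hz : 0 < z)
    (α : ℝ → Fin 2 → ℂ) (hα : Differentiable ℝ α)
    (heq : ∀ s : ℝ, (-(Complex.I * (v : ℂ))) • σ1.mulVec (deriv α s)
        + ((θ : ℂ) * ((κ s : ℝ) : ℂ)) • σ3.mulVec (α s) = ((z : ℝ) : ℂ) • α s)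
    (lam : ℝ) (hlam : lam = Real.sqrt (z ^ 2 + c ^ 2 * μ ^ 2))
    (β γ : ℝ → Fin 2 → ℂ)
    (hβ : ∀ s : ℝ, β s = (((lam + z : ℝ)) : ℂ) • α s
        + (((c * μ : ℝ)) : ℂ) • σ2.mulVec (α s))
    (hγ : ∀ s : ℝ, γ s = (((c * μ : ℝ)) : ℂ) • α s
        - (((lam + z : ℝ)) : ℂ) • σ2.mulVec (α s)) :
    (∀ s : ℝ, (-(Complex.I * (v : ℂ))) • σ1.mulVec (deriv β s)
        + (((c * μ : ℝ)) : ℂ) • σ2.mulVec (β s)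
        + ((θ : ℂ) * ((κ s : ℝ) : ℂ)) • σ3.mulVec (β s) = ((lam : ℝ) : ℂ) • β s) ∧
    (∀ s : ℝ, (-(Complex.I * (v : ℂ))) • σ1.mulVec (deriv γ s)
        + (((c * μ : ℝ)) : ℂ) • σ2.mulVec (γ s)
        + ((θ : ℂ) * ((κ s : ℝ) : ℂ)) • σ3.mulVec (γ s) = (((-lam : ℝ)) : ℂ) • γ s) ∧
    (∀ s : ℝ, α s ≠ 0 → β s ≠ 0 ∧ γ s ≠ 0) := by
  have hsq : lam ^ 2 = z ^ 2 + c ^ 2 * μ ^ 2 := by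
    rw [hlam, Real.sq_sqrt (by positivity)]
  have hlam0 : 0 ≤ lam := hlam ▸ Real.sqrt_nonneg _
  have hsqC : (lam : ℂ) ^ 2 = (z : ℂ) ^ 2 + (c : ℂ) ^ 2 * (μ : ℂ) ^ 2 := by exact_mod_cast hsq
  have hne : ((lam + z : ℝ) : ℂ) ^ 2 - ((c * μ : ℝ) : ℂ) ^ 2 ≠ 0 := by
    have hpos : 0 < (lam + z) ^ 2 - (c * μ) ^ 2 := by
      have : (lam + z) ^ 2 - (c * μ) ^ 2 = 2 * z ^ 2 + 2 * (lam * z) := by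
        linear_combination hsq
      rw [this]
      positivity
    exact_mod_cast hpos.ne'
  have hγ' : ∀ s, γ s = ((c * μ : ℝ) : ℂ) • α s
      + (-((lam + z : ℝ) : ℂ)) • σ2.mulVec (α s) := fun s => by
    rw [hγ, neg_smul, sub_eq_add_neg]
  refine ⟨fun s => ?_, fun s => ?_, fun s hs => ⟨?_, ?_⟩⟩
  · have hd := (hasDerivAt_smul_add_smul_σ2_mulVec (hα s).hasDerivAt
      ((lam + z : ℝ) : ℂ) ((c * μ : ℝ) : ℂ)).deriv
    rw [← funext hβ] at hd
    rw [hd, hβ]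
    apply dirac_smul_add_smul_σ2_mulVec (heq s) <;> push_cast
    · linear_combination -hsqC
    · ring
  · have hd := (hasDerivAt_smul_add_smul_σ2_mulVec (hα s).hasDerivAt
      ((c * μ : ℝ) : ℂ) (-((lam + z : ℝ) : ℂ))).deriv
    rw [← funext hγ'] at hd
    rw [hd, hγ']
    apply dirac_smul_add_smul_σ2_mulVec (heq s) <;> push_cast
    · ring
    · linear_combination -hsqC
  · rw [hβ]
    exact smul_add_smul_σ2_mulVec_ne_zero hne hs
  · rw [hγ']
    refine smul_add_smul_σ2_mulVec_ne_zero ?_ hs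
    rw [neg_sq, ← neg_sub]
    exact neg_ne_zero.mpr hne
end

section
/- Let κ : ℝ → ℝ be continuous, let v > 0, θ > 0, and let c, μ be real numbers. Define α : ℝ → ℂ² by α(s) = exp(−(θ/v)·∫₀ˢ κ(t) dt) · (1, i)ᵀ. Then σ₂·α(s) = α(s) for all s, and α satisfies −i·v·σ₁·α′(s) + c·μ·σ₂·α(s) + θ·κ(s)·σ₃·α(s) = c·μ·α(s) for all s ∈ ℝ. That is, the zero mode of the μ = 0 domain-wall Dirac operator is an eigenfunction of the μ-dependent Dirac operator with eigenvalue c·μ, so the protected eigenvalue branch depends linearly on μ. -/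
theorem σ1_mulVec_smul (a : ℂ) : σ1.mulVec (a • ![1, Complex.I]) = a • ![Complex.I, 1] := by
  rw [Matrix.mulVec_smul]
  congr 1
  ext j
  fin_cases j <;> simp [σ1, Matrix.mulVec, dotProduct, Fin.sum_univ_two]

/-- The vector `(1, i)` is an eigenvector of `σ₂` with eigenvalue `1`. -/
theorem σ2_mulVec_smul (a : ℂ) : σ2.mulVec (a • ![1, Complex.I]) = a • ![1, Complex.I] := by
  rw [Matrix.mulVec_smul]
  congr 1
  ext j
  fin_cases j <;> simp [σ2, Matrix.mulVec, dotProduct, Fin.sum_univ_two]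

theorem σ3_mulVec_smul (a : ℂ) : σ3.mulVec (a • ![1, Complex.I]) = a • ![1, -Complex.I] := by
  rw [Matrix.mulVec_smul]
  congr 1
  ext j
  fin_cases j <;> simp [σ3, Matrix.mulVec, dotProduct, Fin.sum_univ_two]

/-- The derivative of `exp (k ∫₀ˢ κ) • w` for continuous `κ`. -/
theorem hasDerivAt_exp_integral_smul {κ : ℝ → ℝ} (hκ : Continuous κ) (k : ℝ) (w : Fin 2 → ℂ)
    (s : ℝ) :
    HasDerivAt (fun s : ℝ => ((Real.exp (k * ∫ t in (0 : ℝ)..s, κ t) : ℝ) : ℂ) • w)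
      (((Real.exp (k * ∫ t in (0 : ℝ)..s, κ t) * (k * κ s) : ℝ) : ℂ) • w) s :=
  (((hκ.integral_hasStrictDerivAt 0 s).hasDerivAt.const_mul k).exp.ofReal_comp).smul_const w

/-- **Linear dispersion of the protected branch.**
Let `κ` be continuous, `v, θ > 0`, `c, μ ∈ ℝ` and
`α (s) = exp (-(θ/v) ∫₀ˢ κ) • (1, i)ᵀ`.  Then `σ₂ α = α` pointwise and `α` is an
eigenfunction of the μ-dependent Dirac operator
`-i v σ₁ α' + c μ σ₂ α + θ κ σ₃ α` with eigenvalue `c μ`: the protected eigenvalue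
branch depends linearly on `μ`. -/
theorem zero_mode_linear_branch
    (κ : ℝ → ℝ) (hκ : Continuous κ)
    (v θ : ℝ) (hv : 0 < v) (hθ : 0 < θ) (c μ : ℝ)
    (α : ℝ → Fin 2 → ℂ)
    (hα : ∀ s : ℝ, α s =
      ((Real.exp (-(θ / v) * (∫ t in (0:ℝ)..s, κ t)) : ℝ) : ℂ) • ![1, Complex.I]) :
    (∀ s : ℝ, σ2.mulVec (α s) = α s) ∧
    (∀ s : ℝ, (-(Complex.I * (v : ℂ))) • σ1.mulVec (deriv α s)
        + (((c * μ : ℝ)) : ℂ) • σ2.mulVec (α s)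
        + ((θ : ℂ) * ((κ s : ℝ) : ℂ)) • σ3.mulVec (α s)
        = (((c * μ : ℝ)) : ℂ) • α s) := by
  obtain rfl : α = fun s : ℝ =>
      ((Real.exp (-(θ / v) * (∫ t in (0:ℝ)..s, κ t)) : ℝ) : ℂ) • ![1, Complex.I] := funext hα
  refine ⟨fun s => σ2_mulVec_smul _, fun s => ?_⟩
  have hv' : (v : ℂ) ≠ 0 := Complex.ofReal_ne_zero.mpr hv.ne'
  rw [(hasDerivAt_exp_integral_smul hκ (-(θ / v)) ![1, Complex.I] s).deriv, σ1_mulVec_smul,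
    σ2_mulVec_smul, σ3_mulVec_smul]
  beta_reduce
  generalize Real.exp (-(θ / v) * ∫ t in (0 : ℝ)..s, κ t) = E
  ext j
  fin_cases j
  · simp only [Fin.zero_eta, Pi.add_apply, Pi.smul_apply, smul_eq_mul, Matrix.cons_val_zero]
    push_cast
    field_simp
    simp only [Complex.I_sq]
    ring
  · simp only [Fin.mk_one, Pi.add_apply, Pi.smul_apply, smul_eq_mul, Matrix.cons_val_one,
      Matrix.cons_val_zero]
    push_cast
    field_simp
    ring
end
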